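/- arXiv:0809.0476 — 4 statements merged into one kernel-verified Lean document; each statement's English description precedes it below -/
import Mathlib

section
/- Let S be a numerical semigroup and let u be a nonzero element of S. Then the minimum over α ∈ 𝒜(u) of max{ord(w) | w ∈ Ap(S;α)} is equal to the minimum over α ∈ 𝒜(u) of max{ord(p+α) | p ∈ T} (where by convention ord takes the value −1 on integers not in S). -/
namespace GotoNS

/-- `S` is a numerical semigroup: an additive submonoid of `ℕ` with finite
complement, different from `ℕ` itself. -/
def IsNumericalSemigroup (S : Set ℕ) : Prop :=
  (0 : ℕ) ∈ S ∧ (∀ a b, a ∈ S → b ∈ S → a + b ∈ S) ∧ Sᶜ.Finite ∧ S ≠ Set.univ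

/-- The multiplicity `e` of `S`: its smallest nonzero element. -/
noncomputable def mult (S : Set ℕ) : ℕ := sInf {n | n ∈ S ∧ n ≠ 0}

/-- The Frobenius number `f` of `S`: the largest integer not in `S`. -/
noncomputable def frob (S : Set ℕ) : ℕ := sSup {n | n ∉ S}

/-- The `k`-fold sumset `kM` of `M = S \ {0}` (with `0M = {0}`). -/
def kfold (S : Set ℕ) (k : ℕ) : Set ℕ :=
  {s | ∃ c : Fin k → ℕ, (∀ i, c i ∈ S ∧ c i ≠ 0) ∧ ∑ i, c i = s}

/-- The order of `s`: the largest `k` such that `s` is a sum of `k` nonzero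
elements of `S` (`ord 0 = 0`; junk value `0` off `S`). -/
noncomputable def ordS (S : Set ℕ) (s : ℕ) : ℕ := sSup {k | s ∈ kfold S k}

/-- The Apéry set `Ap(S; n) = {w ∈ S | w - n ∉ S}`. -/
def apery (S : Set ℕ) (n : ℕ) : Set ℕ := {w | w ∈ S ∧ ∀ s ∈ S, s + n ≠ w}

/-- `σ(α) = max {ord w | w ∈ Ap(S; α)}`. -/
noncomputable def sigmaS (S : Set ℕ) (α : ℕ) : ℕ := sSup (ordS S '' apery S α)

/-- `𝒜(u) = {α ∈ {1, …, e} | u - α ∈ S}`. -/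
def Aset (S : Set ℕ) (u : ℕ) : Set ℕ :=
  {α | 1 ≤ α ∧ α ≤ mult S ∧ ∃ s ∈ S, s + α = u}

/-- The Goto number `g(u) = min {σ(α) | α ∈ 𝒜(u)}`. -/
noncomputable def goto (S : Set ℕ) (u : ℕ) : ℕ := sInf (sigmaS S '' Aset S u)

/-- `τ`: the minimal Goto number of a nonzero element of `S`. -/
noncomputable def tau (S : Set ℕ) : ℕ := sInf (goto S '' {u | u ∈ S ∧ u ≠ 0})

/-- `ρ`: the maximal Goto number of a nonzero element of `S`. -/
noncomputable def rho (S : Set ℕ) : ℕ := sSup (goto S '' {u | u ∈ S ∧ u ≠ 0})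

/-- An integer belongs to `S` (viewed inside `ℤ`). -/
def memZ (S : Set ℕ) (z : ℤ) : Prop := ∃ n : ℕ, n ∈ S ∧ (n : ℤ) = z

/-- `T = {z ∈ ℤ \ S | z + u ∈ S for all 0 ≠ u ∈ S}`. -/
def Tset (S : Set ℕ) : Set ℤ :=
  {z | ¬ memZ S z ∧ ∀ u : ℕ, u ∈ S → u ≠ 0 → memZ S (z + (u : ℤ))}

open Classical in
/-- The order of an integer, with the convention `ord z = -1` if `z ∉ S`. -/
noncomputable def ordZ (S : Set ℕ) (z : ℤ) : ℤ :=
  if 0 ≤ z ∧ z.toNat ∈ S then (ordS S z.toNat : ℤ) else -1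

/-- `S` is symmetric: for integers `x + y = f`, exactly one of `x, y` lies in `S`. -/
def IsSymmetricNS (S : Set ℕ) : Prop :=
  ∀ x y : ℤ, x + y = (frob S : ℤ) → (memZ S x ↔ ¬ memZ S y)

/-- `u ⪯ u'` iff `u' - u ∈ S`. -/
def preceq (S : Set ℕ) (u u' : ℕ) : Prop := ∃ s ∈ S, u + s = u'

/-- `u ⪯_M u'` iff `u + s = u'` and `ord u + ord s = ord u'` for some `s ∈ S`. -/
def preceqM (S : Set ℕ) (u u' : ℕ) : Prop :=
  ∃ s ∈ S, u + s = u' ∧ ordS S u + ordS S s = ordS S u'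

/-- `Ap(S) \ {0}`. -/
def apNZ (S : Set ℕ) : Set ℕ := apery S (mult S) \ {0}

/-- Minimal elements of `Ap(S) \ {0}` with respect to `⪯`. -/
def minAp (S : Set ℕ) : Set ℕ := {w | w ∈ apNZ S ∧ ∀ w' ∈ apNZ S, preceq S w' w → w' = w}

/-- Maximal elements of `Ap(S) \ {0}` with respect to `⪯`. -/
def maxAp (S : Set ℕ) : Set ℕ := {w | w ∈ apNZ S ∧ ∀ w' ∈ apNZ S, preceq S w w' → w' = w}

/-- Minimal elements of `Ap(S) \ {0}` with respect to `⪯_M`. -/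
def minApM (S : Set ℕ) : Set ℕ := {w | w ∈ apNZ S ∧ ∀ w' ∈ apNZ S, preceqM S w' w → w' = w}

/-- Maximal elements of `Ap(S) \ {0}` with respect to `⪯_M`. -/
def maxApM (S : Set ℕ) : Set ℕ := {w | w ∈ apNZ S ∧ ∀ w' ∈ apNZ S, preceqM S w w' → w' = w}

/-- `S` is pure if all elements of `maxAp S` have the same order. -/
def IsPure (S : Set ℕ) : Prop := ∀ w ∈ maxAp S, ∀ w' ∈ maxAp S, ordS S w = ordS S w'

/-- `S` is `M`-pure if all elements of `maxApM S` have the same order. -/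
def IsMPure (S : Set ℕ) : Prop := ∀ w ∈ maxApM S, ∀ w' ∈ maxApM S, ordS S w = ordS S w'

/-- `S` is `M`-additive if `ord (u + a₁) = ord u + 1` for all `u ∈ S`. -/
def IsMAdditive (S : Set ℕ) : Prop := ∀ u ∈ S, ordS S (u + mult S) = ordS S u + 1

/-- The reduction number `r = min {k | (k+1)M = a₁ + kM}`. -/
noncomputable def redNum (S : Set ℕ) : ℕ :=
  sInf {k | kfold S (k + 1) = (fun x => mult S + x) '' kfold S k}

/-- The set of minimal generators of `S`: nonzero elements of `S` that are not
sums of two nonzero elements of `S`. -/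
def minGens (S : Set ℕ) : Set ℕ :=
  {a | a ∈ S ∧ a ≠ 0 ∧ ∀ x ∈ S, ∀ y ∈ S, x ≠ 0 → y ≠ 0 → x + y ≠ a}

/-- `δ_w = max {ord w + ord w' | w' ∈ S, w + w' ∈ Ap(S)}`. -/
noncomputable def deltaI (S : Set ℕ) (w : ℕ) : ℕ :=
  sSup ((fun w' => ordS S w + ordS S w') '' {w' | w' ∈ S ∧ w + w' ∈ apery S (mult S)})

/-- `δ = min {δ_w | w ∈ Ap(S)}`. -/
noncomputable def deltaNS (S : Set ℕ) : ℕ := sInf (deltaI S '' apery S (mult S))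

/-- `γ_w = max {ord w + ⌊w'/a₁⌋ | w' ∈ S, w + w' ∈ Ap(S)}`. -/
noncomputable def gammaI (S : Set ℕ) (w : ℕ) : ℕ :=
  sSup ((fun w' => ordS S w + w' / mult S) '' {w' | w' ∈ S ∧ w + w' ∈ apery S (mult S)})

/-- `γ = min {γ_w | w ∈ Ap(S)}`. -/
noncomputable def gammaNS (S : Set ℕ) : ℕ := sInf (gammaI S '' apery S (mult S))

/-- `ord(C) = min {ord (f+1), …, ord (f+a₁)}`. -/
noncomputable def ordC (S : Set ℕ) : ℕ :=
  sInf ((fun α => ordS S (frob S + α)) '' Set.Icc 1 (mult S))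

theorem le_of_mem_kfold {S : Set ℕ} {k s : ℕ} (h : s ∈ kfold S k) : k ≤ s := by
  obtain ⟨c, hc, rfl⟩ := h
  calc k = ∑ _i : Fin k, 1 := by simp
    _ ≤ ∑ i, c i := Finset.sum_le_sum fun i _ => Nat.one_le_iff_ne_zero.mpr (hc i).2

theorem add_mem_kfold_succ {S : Set ℕ} {k w s : ℕ} (hw : w ∈ kfold S k) (hs : s ∈ S)
    (hs0 : s ≠ 0) : w + s ∈ kfold S (k + 1) := by
  obtain ⟨c, hc, rfl⟩ := hw
  refine ⟨Fin.cons s c, fun i => ?_, by rw [Fin.sum_cons, add_comm]⟩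
  refine Fin.cases ⟨hs, hs0⟩ (fun j => ?_) i
  simpa using hc j

theorem le_ordS {S : Set ℕ} {k s : ℕ} (h : s ∈ kfold S k) : k ≤ ordS S s :=
  le_csSup ⟨s, fun _ hk => le_of_mem_kfold hk⟩ h

theorem ordS_le_self (S : Set ℕ) (s : ℕ) : ordS S s ≤ s :=
  csSup_le' fun _ hk => le_of_mem_kfold hk

theorem ordS_le_ordS_add {S : Set ℕ} {s : ℕ} (w : ℕ) (hs : s ∈ S) :
    ordS S w ≤ ordS S (w + s) := by
  rcases eq_or_ne s 0 with rfl | hs0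
  · simp
  · exact csSup_le' fun k hk => (Nat.le_succ k).trans (le_ordS (add_mem_kfold_succ hk hs hs0))

theorem ordZ_natCast {S : Set ℕ} {n : ℕ} (hn : n ∈ S) : ordZ S n = ordS S n := by
  simp [ordZ, hn]

theorem ordZ_of_not_memZ {S : Set ℕ} {z : ℤ} (hz : ¬ memZ S z) : ordZ S z = -1 :=
  if_neg fun h => hz ⟨z.toNat, h.2, Int.toNat_of_nonneg h.1⟩

theorem IsNumericalSemigroup.exists_bound {S : Set ℕ} (hS : IsNumericalSemigroup S) :
    ∃ B : ℕ, ∀ z : ℤ, ¬ memZ S z → z ≤ B := by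
  obtain ⟨B, hB⟩ := hS.2.2.1.bddAbove
  refine ⟨B, fun z hz => ?_⟩
  rcases lt_or_ge z 0 with h | h
  · omega
  · lift z to ℕ using h
    exact_mod_cast hB fun hmem => hz ⟨z, hmem, rfl⟩

theorem IsNumericalSemigroup.exists_add_mem_Tset {S : Set ℕ} (hS : IsNumericalSemigroup S)
    {z : ℤ} (hz : ¬ memZ S z) : ∃ s ∈ S, z + (s : ℤ) ∈ Tset S := by
  obtain ⟨B, hB⟩ := hS.exists_bound
  induction hn : (B - z).toNat using Nat.strong_induction_on generalizing z with
  | _ n ih =>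
    by_cases hT : z ∈ Tset S
    · exact ⟨0, hS.1, by simpa using hT⟩
    · obtain ⟨u, hu, hu0, hzu⟩ : ∃ u ∈ S, u ≠ 0 ∧ ¬ memZ S (z + (u : ℤ)) := by
        by_contra! h
        exact hT ⟨hz, h⟩
      have hle := hB _ hzu
      obtain ⟨s, hs, hsT⟩ := ih _ (by omega) hzu rfl
      exact ⟨u + s, hS.2.1 u s hu hs, by push_cast; rwa [← add_assoc]⟩

theorem mem_apery_iff {S : Set ℕ} {n w : ℕ} :
    w ∈ apery S n ↔ w ∈ S ∧ ¬ memZ S ((w : ℤ) - n) := by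
  refine and_congr_right fun _ => ⟨?_, ?_⟩
  · rintro h ⟨s, hs, hsw⟩
    exact h s hs (by omega)
  · intro h s hs hsw
    exact h ⟨s, hs, by omega⟩

theorem IsNumericalSemigroup.bddAbove_ordS_apery {S : Set ℕ} (hS : IsNumericalSemigroup S)
    (n : ℕ) : BddAbove (ordS S '' apery S n) := by
  obtain ⟨B, hB⟩ := hS.exists_bound
  refine ⟨B + n, ?_⟩
  rintro _ ⟨w, hw, rfl⟩
  have hle := hB _ (mem_apery_iff.mp hw).2
  exact (ordS_le_self S w).trans (by omega)

theorem IsNumericalSemigroup.ordZ_add_le_sigmaS {S : Set ℕ} (hS : IsNumericalSemigroup S)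
    (n : ℕ) {p : ℤ} (hp : p ∈ Tset S) : ordZ S (p + (n : ℤ)) ≤ sigmaS S n := by
  by_cases h : memZ S (p + (n : ℤ))
  · obtain ⟨w, hw, hwp⟩ := h
    rw [← hwp, ordZ_natCast hw]
    have hmem : w ∈ apery S n :=
      mem_apery_iff.mpr ⟨hw, by rw [hwp, add_sub_cancel_right]; exact hp.1⟩
    exact_mod_cast le_csSup (hS.bddAbove_ordS_apery n) ⟨w, hmem, rfl⟩
  · rw [ordZ_of_not_memZ h]
    omega

theorem IsNumericalSemigroup.exists_ordS_le_ordZ_add {S : Set ℕ} (hS : IsNumericalSemigroup S)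
    {n w : ℕ} (hw : w ∈ apery S n) :
    ∃ p ∈ Tset S, (ordS S w : ℤ) ≤ ordZ S (p + (n : ℤ)) := by
  obtain ⟨hwS, hwn⟩ := mem_apery_iff.mp hw
  obtain ⟨s, hs, hsT⟩ := hS.exists_add_mem_Tset hwn
  refine ⟨_, hsT, ?_⟩
  have heq : (w : ℤ) - n + s + n = ((w + s : ℕ) : ℤ) := by push_cast; ring
  rw [heq, ordZ_natCast (hS.2.1 w s hwS hs)]
  exact_mod_cast ordS_le_ordS_add w hs

theorem IsNumericalSemigroup.sigmaS_eq_sSup_ordZ {S : Set ℕ} (hS : IsNumericalSemigroup S)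
    {n : ℕ} (hn : 1 ≤ n) :
    (sigmaS S n : ℤ) = sSup ((fun p : ℤ => ordZ S (p + (n : ℤ))) '' Tset S) := by
  have hub : (sigmaS S n : ℤ) ∈ upperBounds ((fun p : ℤ => ordZ S (p + (n : ℤ))) '' Tset S) := by
    rintro _ ⟨p, hp, rfl⟩
    exact hS.ordZ_add_le_sigmaS n hp
  have hne : (apery S n).Nonempty := ⟨0, hS.1, fun s _ => by omega⟩
  obtain ⟨w, hw, hσ⟩ := Nat.sSup_mem (hne.image (ordS S)) (hS.bddAbove_ordS_apery n)
  obtain ⟨p, hp, hle⟩ := hS.exists_ordS_le_ordZ_add hw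
  rw [hσ] at hle
  exact le_antisymm (hle.trans (le_csSup ⟨_, hub⟩ ⟨p, hp, rfl⟩)) (csSup_le ⟨_, p, hp, rfl⟩ hub)

/-- For a numerical semigroup `S` and nonzero `u ∈ S`, the minimum
over `α ∈ 𝒜(u)` of `max {ord w | w ∈ Ap(S; α)}` equals the minimum over
`α ∈ 𝒜(u)` of `max {ord (p + α) | p ∈ T}` (with `ord = -1` off `S`). -/
theorem statement0 (S : Set ℕ) (hS : IsNumericalSemigroup S)
    (u : ℕ) (hu : u ∈ S) (hu0 : u ≠ 0) :
    sInf ((fun α : ℕ => (sigmaS S α : ℤ)) '' Aset S u) =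
      sInf ((fun α : ℕ => sSup ((fun p : ℤ => ordZ S (p + (α : ℤ))) '' Tset S)) '' Aset S u) := by
  exact congrArg sInf (Set.image_congr fun α hα => hS.sigmaS_eq_sSup_ordZ hα.1)

end GotoNS
end

section
/- Let S be a numerical semigroup with minimal generators a_1 < … < a_ν and Frobenius number f. Then: (1) ρ = max{g(a_i) | 1 ≤ i ≤ ν} (in particular ρ is finite); (2) τ = g(u) for every u ∈ S with u ≥ f + a_1 + 1; (3) τ = min{σ(1), σ(2), …, σ(e)}; (4) τ = min{g(a_1), g(f + a_1)}. -/
namespace GotoNS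

theorem IsNumericalSemigroup.mult_mem {S : Set ℕ} (hS : IsNumericalSemigroup S) :
    mult S ∈ S ∧ mult S ≠ 0 := by
  have hne : {n | n ∈ S ∧ n ≠ 0}.Nonempty := by
    have hinf : S.Infinite := compl_compl S ▸ hS.2.2.1.infinite_compl
    obtain ⟨n, hn, h0⟩ := hinf.exists_gt 0
    exact ⟨n, hn, h0.ne'⟩
  exact Nat.sInf_mem hne

theorem mult_le {S : Set ℕ} {n : ℕ} (hn : n ∈ S) (h0 : n ≠ 0) : mult S ≤ n :=
  Nat.sInf_le ⟨hn, h0⟩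

theorem IsNumericalSemigroup.mul_mem {S : Set ℕ} (hS : IsNumericalSemigroup S) {n : ℕ}
    (hn : n ∈ S) (k : ℕ) : n * k ∈ S := by
  induction k with
  | zero => exact hS.1
  | succ k ih => exact hS.2.1 _ _ ih hn

theorem IsNumericalSemigroup.two_le_mult {S : Set ℕ} (hS : IsNumericalSemigroup S) :
    2 ≤ mult S := by
  obtain ⟨hm, h0⟩ := hS.mult_mem
  by_contra h
  have h1 : mult S = 1 := by omega
  refine hS.2.2.2 (Set.eq_univ_of_forall fun n => ?_)
  simpa [h1] using hS.mul_mem hm n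

theorem IsNumericalSemigroup.frob_notMem {S : Set ℕ} (hS : IsNumericalSemigroup S) :
    frob S ∉ S :=
  Nat.sSup_mem (s := {n | n ∉ S}) (Set.nonempty_compl.mpr hS.2.2.2) hS.2.2.1.bddAbove

theorem IsNumericalSemigroup.mem_of_frob_lt {S : Set ℕ} (hS : IsNumericalSemigroup S) {n : ℕ}
    (hn : frob S < n) : n ∈ S := by
  by_contra h
  exact hn.not_ge (le_csSup (s := {n | n ∉ S}) hS.2.2.1.bddAbove h)

/-- There is a multiple of the multiplicity among `u - 1, …, u - e`. -/
theorem IsNumericalSemigroup.Aset_nonempty {S : Set ℕ} (hS : IsNumericalSemigroup S) {u : ℕ}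
    (hu : u ≠ 0) : (Aset S u).Nonempty := by
  obtain ⟨hm, h0⟩ := hS.mult_mem
  have hdiv := Nat.div_add_mod (u - 1) (mult S)
  have hlt := Nat.mod_lt (u - 1) (Nat.pos_of_ne_zero h0)
  exact ⟨(u - 1) % mult S + 1, by omega, by omega, _, hS.mul_mem hm ((u - 1) / mult S), by omega⟩

theorem Aset_subset_Icc (S : Set ℕ) (u : ℕ) : Aset S u ⊆ Set.Icc 1 (mult S) :=
  fun _ h => ⟨h.1, h.2.1⟩

theorem IsNumericalSemigroup.Aset_eq_Icc {S : Set ℕ} (hS : IsNumericalSemigroup S) {u : ℕ}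
    (hu : frob S + mult S + 1 ≤ u) : Aset S u = Set.Icc 1 (mult S) :=
  (Aset_subset_Icc S u).antisymm fun α ⟨h1, h2⟩ =>
    ⟨h1, h2, u - α, hS.mem_of_frob_lt (by omega), by omega⟩

theorem IsNumericalSemigroup.Aset_mult {S : Set ℕ} (hS : IsNumericalSemigroup S) :
    Aset S (mult S) = {mult S} := by
  obtain ⟨-, h0⟩ := hS.mult_mem
  ext α
  constructor
  · rintro ⟨h1, -, s, hs, hsα⟩
    by_cases hs0 : s = 0
    · simpa [hs0] using hsα
    · have := mult_le hs hs0
      omega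
  · rintro rfl
    exact ⟨Nat.pos_of_ne_zero h0, le_rfl, 0, hS.1, zero_add _⟩

theorem IsNumericalSemigroup.Aset_frob_add_mult {S : Set ℕ} (hS : IsNumericalSemigroup S) :
    Aset S (frob S + mult S) = Set.Ico 1 (mult S) := by
  ext α
  constructor
  · rintro ⟨h1, h2, s, hs, hsα⟩
    refine ⟨h1, lt_of_le_of_ne h2 ?_⟩
    rintro rfl
    exact hS.frob_notMem (Nat.add_right_cancel hsα ▸ hs)
  · rintro ⟨h1, h2⟩
    exact ⟨h1, h2.le, frob S + mult S - α, hS.mem_of_frob_lt (by omega), by omega⟩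

theorem IsNumericalSemigroup.exists_minGens_add {S : Set ℕ} (hS : IsNumericalSemigroup S) (u : ℕ)
    (hu : u ∈ S) (h0 : u ≠ 0) : ∃ a ∈ minGens S, ∃ s ∈ S, s + a = u := by
  induction u using Nat.strong_induction_on with
  | _ u ih =>
    by_cases hmin : u ∈ minGens S
    · exact ⟨u, hmin, 0, hS.1, zero_add u⟩
    · simp only [minGens, Set.mem_ofPred_eq, not_and, not_forall, not_not] at hmin
      obtain ⟨x, hx, y, hy, hx0, hy0, hxy⟩ := hmin hu h0
      obtain ⟨a, ha, s, hs, hsa⟩ := ih y (by omega) hy hy0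
      exact ⟨a, ha, x + s, hS.2.1 _ _ hx hs, by omega⟩

theorem IsNumericalSemigroup.goto_add_le {S : Set ℕ} (hS : IsNumericalSemigroup S) {a s : ℕ}
    (ha : a ≠ 0) (hs : s ∈ S) : goto S (s + a) ≤ goto S a := by
  refine csInf_le_csInf (OrderBot.bddBelow _) ((hS.Aset_nonempty ha).image _)
    (Set.image_mono ?_)
  rintro α ⟨h1, h2, t, ht, rfl⟩
  exact ⟨h1, h2, s + t, hS.2.1 _ _ hs ht, by omega⟩

theorem IsNumericalSemigroup.sInf_sigmaS_le_goto {S : Set ℕ} (hS : IsNumericalSemigroup S) {u : ℕ}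
    (hu : u ≠ 0) : sInf (sigmaS S '' Set.Icc 1 (mult S)) ≤ goto S u :=
  csInf_le_csInf (OrderBot.bddBelow _) ((hS.Aset_nonempty hu).image _)
    (Set.image_mono (Aset_subset_Icc S u))

theorem IsNumericalSemigroup.tau_eq_sInf_sigmaS {S : Set ℕ} (hS : IsNumericalSemigroup S) :
    tau S = sInf (sigmaS S '' Set.Icc 1 (mult S)) := by
  have hmem : goto S (frob S + mult S + 1) ∈ goto S '' {u | u ∈ S ∧ u ≠ 0} :=
    ⟨_, ⟨hS.mem_of_frob_lt (by omega), by omega⟩, rfl⟩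
  apply le_antisymm
  · rw [← hS.Aset_eq_Icc le_rfl]
    exact Nat.sInf_le hmem
  · refine le_csInf ⟨_, hmem⟩ ?_
    rintro _ ⟨u, ⟨-, hu⟩, rfl⟩
    exact hS.sInf_sigmaS_le_goto hu

theorem IsNumericalSemigroup.bddAbove_goto {S : Set ℕ} (hS : IsNumericalSemigroup S) :
    BddAbove (goto S '' {u | u ∈ S ∧ u ≠ 0}) := by
  refine ((Set.finite_Icc 1 (mult S)).image (sigmaS S)).bddAbove.mono ?_
  rintro _ ⟨u, ⟨-, hu⟩, rfl⟩
  exact Set.image_mono (Aset_subset_Icc S u) (Nat.sInf_mem ((hS.Aset_nonempty hu).image _))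

theorem IsNumericalSemigroup.rho_eq_sSup_minGens {S : Set ℕ} (hS : IsNumericalSemigroup S) :
    rho S = sSup (goto S '' minGens S) := by
  have hsub : goto S '' minGens S ⊆ goto S '' {u | u ∈ S ∧ u ≠ 0} :=
    Set.image_mono fun _ h => ⟨h.1, h.2.1⟩
  have hm := hS.mult_mem
  obtain ⟨b, hb, -⟩ := hS.exists_minGens_add _ hm.1 hm.2
  apply le_antisymm
  · refine csSup_le ⟨_, mult S, hm, rfl⟩ ?_
    rintro _ ⟨u, ⟨hu, hu0⟩, rfl⟩
    obtain ⟨a, ha, s, hs, rfl⟩ := hS.exists_minGens_add u hu hu0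
    exact (hS.goto_add_le ha.2.1 hs).trans
      (le_csSup (hS.bddAbove_goto.mono hsub) ⟨a, ha, rfl⟩)
  · exact csSup_le_csSup hS.bddAbove_goto ⟨_, b, hb, rfl⟩ hsub

theorem IsNumericalSemigroup.tau_eq_min {S : Set ℕ} (hS : IsNumericalSemigroup S) :
    tau S = min (goto S (mult S)) (goto S (frob S + mult S)) := by
  have h2 := hS.two_le_mult
  have hIcc : Set.Icc 1 (mult S) = {mult S} ∪ Set.Ico 1 (mult S) := by
    ext α
    simp only [Set.mem_Icc, Set.mem_union, Set.mem_singleton_iff, Set.mem_Ico]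
    omega
  rw [hS.tau_eq_sInf_sigmaS, hIcc, Set.image_union,
    csInf_union (OrderBot.bddBelow _) ((Set.singleton_nonempty _).image _)
      (OrderBot.bddBelow _) ((Set.nonempty_Ico.mpr (by omega)).image _)]
  simp only [goto, hS.Aset_mult, hS.Aset_frob_add_mult]

/-- basic facts about `ρ` and `τ`. -/
theorem statement3 (S : Set ℕ) (hS : IsNumericalSemigroup S)
    (ν : ℕ) (a : Fin ν → ℕ) (ha : StrictMono a) (hgen : Set.range a = minGens S) :
    rho S = sSup (goto S '' Set.range a) ∧
    (∀ u ∈ S, frob S + mult S + 1 ≤ u → tau S = goto S u) ∧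
    tau S = sInf (sigmaS S '' Set.Icc 1 (mult S)) ∧
    tau S = min (goto S (mult S)) (goto S (frob S + mult S)) := by
  rw [hgen]
  refine ⟨hS.rho_eq_sSup_minGens, fun u _ hu => ?_, hS.tau_eq_sInf_sigmaS, hS.tau_eq_min⟩
  rw [hS.tau_eq_sInf_sigmaS, ← hS.Aset_eq_Icc hu, goto]

end GotoNS
end

section
/- Let S be a numerical semigroup with Frobenius number f, multiplicity e = a_1, and Ap(S) = {w_0 < w_1 < ⋯ < w_{e−1}}. The following are equivalent: (1) S is symmetric; (2) maxAp(S) = {f + a_1}; (3) maxAp(S) has exactly one element; (4) w_i + w_j = w_{e−1} whenever i + j = e − 1; (5) w_i ⪯ w_{e−1} for all 0 ≤ i ≤ e − 1. -/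
namespace GotoNS

namespace IsNumericalSemigroup

variable {S : Set ℕ}

lemma mult_mem_s10 (hS : IsNumericalSemigroup S) : mult S ∈ S ∧ mult S ≠ 0 := by
  obtain ⟨-, -, hfin, -⟩ := hS
  obtain ⟨m, hm, hm0⟩ : ∃ m, m ∈ S ∧ m ≠ 0 := by
    by_contra! h
    refine Set.infinite_of_injective_forall_mem (f := Nat.succ) Nat.succ_injective ?_ hfin
    exact fun m hm => Nat.succ_ne_zero m (h _ hm)
  exact Nat.sInf_mem (s := {n | n ∈ S ∧ n ≠ 0}) ⟨m, hm, hm0⟩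

lemma frob_notMem_s10 (hS : IsNumericalSemigroup S) : frob S ∉ S := by
  obtain ⟨-, -, hfin, hne⟩ := hS
  exact Nat.sSup_mem (s := {n | n ∉ S}) ((Set.ne_univ_iff_exists_notMem S).1 hne) hfin.bddAbove

lemma mem_of_frob_lt_s10 (hS : IsNumericalSemigroup S) {m : ℕ} (hm : frob S < m) : m ∈ S := by
  by_contra h
  exact hm.not_ge (le_csSup (Set.Finite.bddAbove hS.2.2.1) h)

lemma add_mul_mult_mem (hS : IsNumericalSemigroup S) {a : ℕ} (ha : a ∈ S) (k : ℕ) :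
    a + k * mult S ∈ S := by
  induction k with
  | zero => simpa
  | succ k ih =>
    rw [Nat.succ_mul, ← add_assoc]
    exact hS.2.1 _ _ ih hS.mult_mem_s10.1

lemma frob_add_mult_mem_apery (hS : IsNumericalSemigroup S) :
    frob S + mult S ∈ apery S (mult S) := by
  refine ⟨hS.mem_of_frob_lt_s10 (Nat.lt_add_of_pos_right (Nat.pos_of_ne_zero hS.mult_mem_s10.2)), ?_⟩
  intro s hs h
  exact hS.frob_notMem_s10 (Nat.add_right_cancel h ▸ hs)

lemma le_of_mem_apery (hS : IsNumericalSemigroup S) {x : ℕ} (hx : x ∈ apery S (mult S)) :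
    x ≤ frob S + mult S := by
  by_contra! h
  exact hx.2 (x - mult S) (hS.mem_of_frob_lt_s10 (by omega)) (by omega)

lemma frob_add_mult_mem_maxAp (hS : IsNumericalSemigroup S) : frob S + mult S ∈ maxAp S := by
  have hpos := hS.mult_mem_s10.2
  refine ⟨⟨hS.frob_add_mult_mem_apery, ?_⟩, ?_⟩
  · simp only [Set.mem_singleton_iff]
    omega
  · rintro x ⟨hx, -⟩ ⟨s, -, h⟩
    have := hS.le_of_mem_apery hx
    omega

lemma exists_preceq_mem_maxAp (hS : IsNumericalSemigroup S) {x : ℕ} (hx : x ∈ apNZ S) :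
    ∃ y ∈ maxAp S, preceq S x y := by
  have hfin : {y | y ∈ apNZ S ∧ preceq S x y}.Finite :=
    (Set.finite_Iic (frob S + mult S)).subset fun y hy => hS.le_of_mem_apery hy.1.1
  obtain ⟨y, ⟨hy, s, hs, hxy⟩, hmax⟩ :=
    Set.exists_max_image _ id hfin ⟨x, hx, 0, hS.1, add_zero x⟩
  refine ⟨y, ⟨hy, ?_⟩, s, hs, hxy⟩
  rintro z hz ⟨t, ht, hyz⟩
  have : z ≤ y := hmax z ⟨hz, s + t, hS.2.1 _ _ hs ht, by omega⟩
  omega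

/-- The Apéry set meets every residue class modulo the multiplicity. -/
lemma exists_apery_dvd_sub (hS : IsNumericalSemigroup S) (x : ℤ) :
    ∃ a ∈ apery S (mult S), (mult S : ℤ) ∣ x - a := by
  classical
  have hpos := Nat.pos_of_ne_zero hS.mult_mem_s10.2
  have hex : ∃ a : ℕ, a ∈ S ∧ (mult S : ℤ) ∣ x - a := by
    have hmod : 0 ≤ x % (mult S : ℤ) := Int.emod_nonneg _ (by omega)
    refine ⟨(x % (mult S : ℤ)).toNat + (frob S + 1) * mult S, hS.mem_of_frob_lt_s10 ?_, ?_⟩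
    · nlinarith [Nat.zero_le (x % (mult S : ℤ)).toNat]
    · refine ⟨x / mult S - (frob S + 1), ?_⟩
      push_cast
      rw [Int.toNat_of_nonneg hmod]
      linarith [Int.emod_add_mul_ediv x (mult S : ℤ)]
  obtain ⟨hmem, hdvd⟩ := Nat.find_spec hex
  refine ⟨Nat.find hex, ⟨hmem, fun s hs h => ?_⟩, hdvd⟩
  refine Nat.find_min hex (m := s) (by omega) ⟨hs, ?_⟩
  rw [← h] at hdvd
  have : x - (s : ℤ) = x - ((s + mult S : ℕ) : ℤ) + mult S := by push_cast; ring
  rw [this]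
  exact dvd_add_self_right.2 hdvd

/-- In a symmetric semigroup, `x ↦ f + e - x` preserves the Apéry set. -/
lemma sub_mem_apery (hS : IsNumericalSemigroup S) (hsymm : IsSymmetricNS S) {x : ℕ}
    (hx : x ∈ apery S (mult S)) : frob S + mult S - x ∈ apery S (mult S) := by
  have hle := hS.le_of_mem_apery hx
  constructor
  · obtain ⟨m, hm, h⟩ := (hsymm (frob S + mult S - x) (x - mult S) (by ring)).2 (by
      rintro ⟨m, hm, h⟩
      exact hx.2 m hm (by omega))
    rwa [show frob S + mult S - x = m by omega]
  · intro s hs h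
    exact (hsymm s x (by omega)).1 ⟨s, hs, rfl⟩ ⟨x, hx.1, rfl⟩

lemma isSymmetricNS_of_preceq (hS : IsNumericalSemigroup S)
    (h : ∀ a ∈ apery S (mult S), preceq S a (frob S + mult S)) : IsSymmetricNS S := by
  intro x y hxy
  constructor
  · rintro ⟨p, hp, rfl⟩ ⟨q, hq, rfl⟩
    exact hS.frob_notMem_s10 ((by omega : p + q = frob S) ▸ hS.2.1 _ _ hp hq)
  · intro hy
    obtain ⟨a, ha, k, hk⟩ := hS.exists_apery_dvd_sub x
    obtain ⟨b, hb, hab⟩ := h a ha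
    have hab' : (a : ℤ) + b = frob S + mult S := by exact_mod_cast hab
    rcases le_or_gt 0 k with hk0 | hk0
    · lift k to ℕ using hk0
      refine ⟨a + k * mult S, hS.add_mul_mult_mem ha.1 k, ?_⟩
      push_cast
      linarith
    · refine absurd ⟨b + (-k - 1).toNat * mult S, hS.add_mul_mult_mem hb _, ?_⟩ hy
      push_cast
      rw [Int.toNat_of_nonneg (by omega)]
      linarith

end IsNumericalSemigroup

/-- characterizations of symmetry. -/
theorem statement10 (S : Set ℕ) (hS : IsNumericalSemigroup S)
    (n : ℕ) (w : Fin (n + 1) → ℕ) (hw : StrictMono w)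
    (hrange : Set.range w = apery S (mult S)) (hn : n + 1 = mult S) :
    List.TFAE [IsSymmetricNS S,
      maxAp S = {frob S + mult S},
      ∃ x, maxAp S = {x},
      ∀ i j : Fin (n + 1), (i : ℕ) + (j : ℕ) = n → w i + w j = w (Fin.last n),
      ∀ i : Fin (n + 1), preceq S (w i) (w (Fin.last n))] := by
  have hmem (i) : w i ∈ apery S (mult S) := hrange ▸ Set.mem_range_self i
  have hlast : w (Fin.last n) = frob S + mult S := by
    refine le_antisymm (hS.le_of_mem_apery (hmem _)) ?_
    obtain ⟨i, hi⟩ : frob S + mult S ∈ Set.range w := hrange ▸ hS.frob_add_mult_mem_apery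
    exact hi ▸ hw.monotone (Fin.le_last i)
  rw [hlast]
  tfae_have 1 → 4 := by
    intro hsymm i j hij
    have hle (i) : w i ≤ frob S + mult S := hS.le_of_mem_apery (hmem i)
    have hmono : StrictMono fun i : Fin (n + 1) => frob S + mult S - w i.rev := by
      intro a b hab
      have := hw (Fin.rev_lt_rev.2 hab)
      have := hle a.rev
      dsimp only
      omega
    have hrev : (fun i : Fin (n + 1) => frob S + mult S - w i.rev) = w := by
      refine (hmono.range_inj hw).1 (Set.Subset.antisymm ?_ ?_)
      · rintro _ ⟨i, rfl⟩
        exact hrange ▸ hS.sub_mem_apery hsymm (hmem _)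
      · rintro _ ⟨i, rfl⟩
        obtain ⟨k, hk⟩ : frob S + mult S - w i ∈ Set.range w :=
          hrange ▸ hS.sub_mem_apery hsymm (hmem i)
        refine ⟨k.rev, ?_⟩
        have := hle i
        simp only [Fin.rev_rev]
        omega
    have hj : j = i.rev := Fin.ext (by rw [Fin.val_rev]; omega)
    have := congrFun hrev i
    have := hle j
    subst hj
    omega
  tfae_have 4 → 5 := fun h i =>
    ⟨w i.rev, (hmem _).1, h i i.rev (by rw [Fin.val_rev]; omega)⟩
  tfae_have 5 → 2 := by
    intro h
    refine Set.Subset.antisymm ?_ (Set.singleton_subset_iff.2 hS.frob_add_mult_mem_maxAp)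
    intro x hx
    obtain ⟨i, rfl⟩ : x ∈ Set.range w := hrange ▸ hx.1.1
    exact (hx.2 _ hS.frob_add_mult_mem_maxAp.1 (h i)).symm
  tfae_have 2 → 3 := fun h => ⟨_, h⟩
  tfae_have 3 → 5 := by
    rintro ⟨x, hx⟩ i
    have hfx : frob S + mult S = x := by
      simpa [hx] using hS.frob_add_mult_mem_maxAp
    by_cases h0 : w i = 0
    · exact ⟨_, hS.frob_add_mult_mem_apery.1, by rw [h0, zero_add]⟩
    · obtain ⟨y, hy, hiy⟩ := hS.exists_preceq_mem_maxAp ⟨hmem i, h0⟩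
      rw [hx, Set.mem_singleton_iff] at hy
      rwa [hfx, ← hy]
  tfae_have 5 → 1 := by
    intro h
    refine hS.isSymmetricNS_of_preceq fun a ha => ?_
    obtain ⟨i, rfl⟩ : a ∈ Set.range w := hrange ▸ ha
    exact h i
  tfae_finish

end GotoNS
end

section
/- Let S be a numerical semigroup with multiplicity e = a_1, Goto number g(a_1), and reduction number r. If S is M-additive, then g(a_1) = r. Conversely, if S is M-pure and g(a_1) = r, then S is M-additive. -/
namespace GotoNS

theorem mem_kfold_zero {S : Set ℕ} {s : ℕ} : s ∈ kfold S 0 ↔ s = 0 := by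
  simp [kfold, eq_comm]

theorem mem_kfold_succ {S : Set ℕ} {k s : ℕ} :
    s ∈ kfold S (k + 1) ↔ ∃ m ∈ S, m ≠ 0 ∧ ∃ t ∈ kfold S k, m + t = s := by
  constructor
  · rintro ⟨c, hc, rfl⟩
    exact ⟨c 0, (hc 0).1, (hc 0).2, _, ⟨fun i => c i.succ, fun i => hc _, rfl⟩,
      (Fin.sum_univ_succ c).symm⟩
  · rintro ⟨m, hm, hm0, t, ⟨c, hc, rfl⟩, rfl⟩
    refine ⟨Fin.cons m c, fun i => ?_, by simp [Fin.sum_univ_succ]⟩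
    refine Fin.cases ?_ (fun j => ?_) i
    · simpa using ⟨hm, hm0⟩
    · simpa using hc j

theorem add_mem_kfold {S : Set ℕ} {j k a b : ℕ} (ha : a ∈ kfold S j) (hb : b ∈ kfold S k) :
    a + b ∈ kfold S (j + k) := by
  induction j generalizing a with
  | zero =>
    rw [mem_kfold_zero] at ha
    simpa [ha] using hb
  | succ j ih =>
    obtain ⟨m, hm, hm0, t, ht, rfl⟩ := mem_kfold_succ.1 ha
    rw [add_right_comm]
    exact mem_kfold_succ.2 ⟨m, hm, hm0, t + b, ih ht, by ring⟩

theorem mem_kfold_one {S : Set ℕ} {s : ℕ} : s ∈ kfold S 1 ↔ s ∈ S ∧ s ≠ 0 := by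
  simp [mem_kfold_succ, mem_kfold_zero]

theorem IsNumericalSemigroup.mem_of_mem_kfold {S : Set ℕ} (hS : IsNumericalSemigroup S) {k s : ℕ}
    (h : s ∈ kfold S k) : s ∈ S := by
  induction k generalizing s with
  | zero => exact mem_kfold_zero.1 h ▸ hS.1
  | succ k ih =>
    obtain ⟨m, hm, -, t, ht, rfl⟩ := mem_kfold_succ.1 h
    exact hS.2.1 _ _ hm (ih ht)

theorem mem_kfold_ordS {S : Set ℕ} {s : ℕ} (hs : s ∈ S) : s ∈ kfold S (ordS S s) := by
  refine Nat.sSup_mem (s := {k | s ∈ kfold S k}) ?_ ⟨s, fun _ hj => le_of_mem_kfold hj⟩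
  rcases eq_or_ne s 0 with h | h
  · exact ⟨0, mem_kfold_zero.2 h⟩
  · exact ⟨1, mem_kfold_one.2 ⟨hs, h⟩⟩

theorem ordS_add_le {S : Set ℕ} {a b : ℕ} (ha : a ∈ S) (hb : b ∈ S) :
    ordS S a + ordS S b ≤ ordS S (a + b) :=
  le_ordS (add_mem_kfold (mem_kfold_ordS ha) (mem_kfold_ordS hb))

theorem one_le_ordS {S : Set ℕ} {s : ℕ} (hs : s ∈ S) (h : s ≠ 0) : 1 ≤ ordS S s :=
  le_ordS (mem_kfold_one.2 ⟨hs, h⟩)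

theorem ordS_zero (S : Set ℕ) (h0 : 0 ∈ S) : ordS S 0 = 0 :=
  Nat.le_zero.1 (le_of_mem_kfold (mem_kfold_ordS h0))

theorem IsNumericalSemigroup.kfold_anti {S : Set ℕ} (hS : IsNumericalSemigroup S) {j k s : ℕ}
    (hj : 1 ≤ j) (hjk : j ≤ k) (h : s ∈ kfold S k) : s ∈ kfold S j := by
  induction k, hjk using Nat.le_induction with
  | base => exact h
  | succ k hk ih =>
    apply ih
    obtain ⟨i, rfl⟩ : ∃ i, k = i + 1 := ⟨k - 1, by omega⟩
    obtain ⟨m, hm, hm0, t, ht, rfl⟩ := mem_kfold_succ.1 h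
    obtain ⟨n, hn, hn0, u, hu, rfl⟩ := mem_kfold_succ.1 ht
    exact mem_kfold_succ.2 ⟨m + n, hS.2.1 _ _ hm hn, by omega, u, hu, by ring⟩

theorem IsNumericalSemigroup.exists_forall_ge_mem {S : Set ℕ} (hS : IsNumericalSemigroup S) :
    ∃ N, ∀ n, N ≤ n → n ∈ S := by
  obtain ⟨N, hN⟩ := hS.2.2.1.bddAbove
  refine ⟨N + 1, fun n hn => ?_⟩
  by_contra h
  have := hN h
  omega

theorem mult_le_s13 {S : Set ℕ} {s : ℕ} (hs : s ∈ S) (h : s ≠ 0) : mult S ≤ s :=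
  Nat.sInf_le ⟨hs, h⟩

theorem IsNumericalSemigroup.mult_ne_one {S : Set ℕ} (hS : IsNumericalSemigroup S) :
    mult S ≠ 1 := by
  intro h
  apply hS.2.2.2
  have h1 : 1 ∈ S := h ▸ hS.mult_mem.1
  refine Set.eq_univ_of_forall fun n => ?_
  induction n with
  | zero => exact hS.1
  | succ n ih => exact hS.2.1 _ _ ih h1

theorem IsNumericalSemigroup.bddAbove_apery {S : Set ℕ} (hS : IsNumericalSemigroup S) (n : ℕ) :
    BddAbove (apery S n) := by
  obtain ⟨N, hN⟩ := hS.exists_forall_ge_mem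
  refine ⟨N + n, fun w hw => ?_⟩
  by_contra! h
  exact hw.2 (w - n) (hN _ (by omega)) (by omega)

theorem IsNumericalSemigroup.exists_apery_add {S : Set ℕ} (hS : IsNumericalSemigroup S) {u : ℕ}
    (hu : u ∈ S) : ∃ w ∈ apery S (mult S), ∃ q, u = w + q * mult S := by
  induction u using Nat.strong_induction_on with
  | _ u ih =>
    by_cases h : u ∈ apery S (mult S)
    · exact ⟨u, h, 0, by simp⟩
    · obtain ⟨s, hs, rfl⟩ : ∃ s ∈ S, s + mult S = u := by
        by_contra! h'
        exact h ⟨hu, h'⟩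
      have := hS.mult_mem.2
      obtain ⟨w, hw, q, rfl⟩ := ih s (by omega) hs
      exact ⟨w, hw, q + 1, by ring⟩

theorem IsNumericalSemigroup.apNZ_nonempty {S : Set ℕ} (hS : IsNumericalSemigroup S) :
    (apNZ S).Nonempty := by
  obtain ⟨N, hN⟩ := hS.exists_forall_ge_mem
  have he := hS.mult_mem.2
  have he1 := hS.mult_ne_one
  have hNe : N ≤ N * mult S := Nat.le_mul_of_pos_right _ (by omega)
  obtain ⟨w, hw, q, hq⟩ := hS.exists_apery_add (hN (N * mult S + 1) (by omega))
  refine ⟨w, hw, ?_⟩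
  rintro rfl
  have h1 : mult S ∣ N * mult S + 1 := ⟨q, by rw [hq]; ring⟩
  have h2 := (Nat.dvd_add_right (Dvd.intro_left N rfl)).1 h1
  exact he1 (Nat.dvd_one.1 h2)

theorem IsNumericalSemigroup.goto_mult {S : Set ℕ} (hS : IsNumericalSemigroup S) :
    goto S (mult S) = sigmaS S (mult S) := by
  have : Aset S (mult S) = {mult S} := by
    ext α
    simp only [Aset, Set.mem_ofPred_eq, Set.mem_singleton_iff]
    constructor
    · rintro ⟨h1, -, s, hs, h⟩
      rcases eq_or_ne s 0 with h0 | h0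
      · omega
      · have := mult_le_s13 hs h0
        omega
    · rintro rfl
      have := hS.mult_mem.2
      exact ⟨by omega, le_rfl, 0, hS.1, by simp⟩
  simp [goto, this]

theorem IsNumericalSemigroup.ordS_le_sigmaS {S : Set ℕ} (hS : IsNumericalSemigroup S) {n w : ℕ}
    (hw : w ∈ apery S n) : ordS S w ≤ sigmaS S n :=
  le_csSup (hS.bddAbove_ordS_apery n) ⟨w, hw, rfl⟩

theorem IsNumericalSemigroup.one_le_sigmaS_mult {S : Set ℕ} (hS : IsNumericalSemigroup S) :
    1 ≤ sigmaS S (mult S) := by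
  obtain ⟨w, hw, hw0⟩ := hS.apNZ_nonempty
  exact (one_le_ordS hw.1 hw0).trans (hS.ordS_le_sigmaS hw)

theorem IsNumericalSemigroup.exists_ordS_eq_sigmaS {S : Set ℕ} (hS : IsNumericalSemigroup S) :
    ∃ w ∈ apNZ S, ordS S w = sigmaS S (mult S) := by
  obtain ⟨v, hv, -⟩ := hS.apNZ_nonempty
  obtain ⟨w, hw, h⟩ : sigmaS S (mult S) ∈ ordS S '' apery S (mult S) :=
    Nat.sSup_mem ⟨_, v, hv, rfl⟩ (hS.bddAbove_ordS_apery _)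
  refine ⟨w, ⟨hw, ?_⟩, h⟩
  rintro rfl
  have := hS.one_le_sigmaS_mult
  rw [ordS_zero S hS.1] at h
  omega

theorem IsNumericalSemigroup.sigmaS_le_of_kfold_succ_eq {S : Set ℕ} (hS : IsNumericalSemigroup S)
    {k : ℕ} (h : kfold S (k + 1) = (fun x => mult S + x) '' kfold S k) :
    sigmaS S (mult S) ≤ k := by
  obtain ⟨w, hw, hw'⟩ := hS.exists_ordS_eq_sigmaS
  by_contra! hk
  have hmem := hS.kfold_anti (by omega) (show k + 1 ≤ ordS S w by omega) (mem_kfold_ordS hw.1.1)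
  rw [h] at hmem
  obtain ⟨t, ht, hwt⟩ := hmem
  exact hw.1.2 t (hS.mem_of_mem_kfold ht) ((add_comm _ _).trans hwt)

theorem IsNumericalSemigroup.kfold_sigmaS_succ_eq {S : Set ℕ} (hS : IsNumericalSemigroup S)
    (hadd : IsMAdditive S) :
    kfold S (sigmaS S (mult S) + 1) = (fun x => mult S + x) '' kfold S (sigmaS S (mult S)) := by
  ext s
  constructor
  · intro hs
    have hle := le_ordS hs
    have hsS := hS.mem_of_mem_kfold hs
    obtain ⟨u, hu, rfl⟩ : ∃ u ∈ S, u + mult S = s := by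
      by_contra! h'
      have := hS.ordS_le_sigmaS (n := mult S) ⟨hsS, h'⟩
      omega
    rw [hadd u hu] at hle
    exact ⟨u, hS.kfold_anti hS.one_le_sigmaS_mult (by omega) (mem_kfold_ordS hu), add_comm _ _⟩
  · rintro ⟨t, ht, rfl⟩
    exact mem_kfold_succ.2 ⟨_, hS.mult_mem.1, hS.mult_mem.2, t, ht, rfl⟩

theorem exists_of_mem_kfold_succ {S : Set ℕ} {r : ℕ}
    (h : kfold S (r + 1) = (fun x => mult S + x) '' kfold S r) {k s : ℕ} (hk : r ≤ k)
    (hs : s ∈ kfold S (k + 1)) : ∃ t ∈ kfold S k, mult S + t = s := by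
  induction k, hk using Nat.le_induction generalizing s with
  | base => rwa [h] at hs
  | succ k hk ih =>
    obtain ⟨m, hm, hm0, s', hs', rfl⟩ := mem_kfold_succ.1 hs
    obtain ⟨t, ht, rfl⟩ := ih hs'
    exact ⟨m + t, mem_kfold_succ.2 ⟨m, hm, hm0, t, ht, rfl⟩, by ring⟩

theorem IsNumericalSemigroup.mul_mult_mem {S : Set ℕ} (hS : IsNumericalSemigroup S) (q : ℕ) :
    q * mult S ∈ kfold S q := by
  induction q with
  | zero => simp [mem_kfold_zero]
  | succ q ih =>
    exact mem_kfold_succ.2 ⟨_, hS.mult_mem.1, hS.mult_mem.2, _, ih, by ring⟩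

theorem IsNumericalSemigroup.le_ordS_add_mul {S : Set ℕ} (hS : IsNumericalSemigroup S) {u : ℕ}
    (hu : u ∈ S) (q : ℕ) : ordS S u + q ≤ ordS S (u + q * mult S) :=
  le_ordS (add_mem_kfold (mem_kfold_ordS hu) (hS.mul_mult_mem q))

theorem IsNumericalSemigroup.ordS_add_mul_eq {S : Set ℕ} (hS : IsNumericalSemigroup S) {r u : ℕ}
    (h : kfold S (r + 1) = (fun x => mult S + x) '' kfold S r) (hu : u ∈ S)
    (hr : r ≤ ordS S u) (q : ℕ) : ordS S (u + q * mult S) = ordS S u + q := by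
  induction q with
  | zero => simp
  | succ q ih =>
    have hle := hS.le_ordS_add_mul hu (q + 1)
    have hmem : u + (q + 1) * mult S ∈ S :=
      hS.2.1 _ _ hu (hS.mem_of_mem_kfold (hS.mul_mult_mem _))
    obtain ⟨k, hk⟩ : ∃ k, ordS S (u + (q + 1) * mult S) = k + 1 :=
      ⟨ordS S (u + (q + 1) * mult S) - 1, by omega⟩
    have hmem' := mem_kfold_ordS hmem
    rw [hk] at hmem'
    obtain ⟨t, ht, hte⟩ := exists_of_mem_kfold_succ h (by omega) hmem'
    obtain rfl : t = u + q * mult S := by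
      rw [add_mul] at hte
      omega
    have := le_ordS ht
    omega

theorem IsNumericalSemigroup.preceqM_trans {S : Set ℕ} (hS : IsNumericalSemigroup S) {a b c : ℕ}
    (ha : a ∈ S) (hab : preceqM S a b) (hbc : preceqM S b c) : preceqM S a c := by
  obtain ⟨s, hs, rfl, h1⟩ := hab
  obtain ⟨t, ht, rfl, h2⟩ := hbc
  have hst := hS.2.1 _ _ hs ht
  refine ⟨s + t, hst, by ring, ?_⟩
  have h3 := ordS_add_le hs ht
  have h4 := ordS_add_le ha hst
  rw [← add_assoc] at h4
  omega

theorem IsNumericalSemigroup.exists_maxApM {S : Set ℕ} (hS : IsNumericalSemigroup S) {w : ℕ}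
    (hw : w ∈ apNZ S) : ∃ v ∈ maxApM S, preceqM S w v := by
  let T := {v | v ∈ apNZ S ∧ preceqM S w v}
  have hbdd : BddAbove T := (hS.bddAbove_apery (mult S)).mono fun v hv => hv.1.1
  have hne : T.Nonempty := ⟨w, hw, 0, hS.1, by simp, by simp [ordS_zero S hS.1]⟩
  obtain ⟨hv, hwv⟩ : sSup T ∈ T := Nat.sSup_mem hne hbdd
  refine ⟨sSup T, ⟨hv, fun x hx hvx => ?_⟩, hwv⟩
  refine le_antisymm (le_csSup hbdd ⟨hx, hS.preceqM_trans hw.1.1 hwv hvx⟩) ?_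
  obtain ⟨s, -, h, -⟩ := hvx
  omega

theorem IsNumericalSemigroup.mem_maxApM_of_ordS_eq {S : Set ℕ} (hS : IsNumericalSemigroup S)
    {w : ℕ} (hw : w ∈ apNZ S) (h : ordS S w = sigmaS S (mult S)) : w ∈ maxApM S := by
  refine ⟨hw, ?_⟩
  rintro x hx ⟨s, hs, rfl, ho⟩
  have h1 := hS.ordS_le_sigmaS hx.1
  rcases eq_or_ne s 0 with rfl | h0
  · rfl
  · have := one_le_ordS hs h0
    omega

theorem IsNumericalSemigroup.exists_preceqM_ordS_eq {S : Set ℕ} (hS : IsNumericalSemigroup S)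
    (hpure : IsMPure S) {w : ℕ} (hw : w ∈ apery S (mult S)) :
    ∃ v ∈ S, ordS S v = sigmaS S (mult S) ∧ preceqM S w v := by
  obtain ⟨x, hx, hxo⟩ := hS.exists_ordS_eq_sigmaS
  rcases eq_or_ne w 0 with rfl | h0
  · exact ⟨x, hx.1.1, hxo, x, hx.1.1, by simp, by simp [ordS_zero S hS.1]⟩
  · obtain ⟨v, hv, hwv⟩ := hS.exists_maxApM ⟨hw, h0⟩
    exact ⟨v, hv.1.1.1, (hpure v hv x (hS.mem_maxApM_of_ordS_eq hx hxo)).trans hxo, hwv⟩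

theorem IsNumericalSemigroup.isMAdditive_of_isMPure {S : Set ℕ} (hS : IsNumericalSemigroup S)
    (hpure : IsMPure S)
    (h : kfold S (sigmaS S (mult S) + 1) =
      (fun x => mult S + x) '' kfold S (sigmaS S (mult S))) : IsMAdditive S := by
  have key : ∀ w ∈ apery S (mult S), ∀ q, ordS S (w + q * mult S) = ordS S w + q := by
    intro w hw q
    refine le_antisymm ?_ (hS.le_ordS_add_mul hw.1 q)
    obtain ⟨v, hv, hvo, s, hs, rfl, ho⟩ := hS.exists_preceqM_ordS_eq hpure hw
    have h1 := hS.ordS_add_mul_eq h hv hvo.ge q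
    have h2 := ordS_add_le (hS.2.1 _ _ hw.1 (hS.mem_of_mem_kfold (hS.mul_mult_mem q))) hs
    rw [add_right_comm] at h2
    omega
  intro u hu
  obtain ⟨w, hw, q, rfl⟩ := hS.exists_apery_add hu
  have := key w hw (q + 1)
  rw [add_one_mul, ← add_assoc] at this
  rw [this, key w hw q, add_assoc]

/-- `M`-additive implies `g(a₁) = r`; conversely if `S` is
`M`-pure and `g(a₁) = r` then `S` is `M`-additive. -/
theorem statement13 (S : Set ℕ) (hS : IsNumericalSemigroup S) :
    (IsMAdditive S → goto S (mult S) = redNum S) ∧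
    (IsMPure S → goto S (mult S) = redNum S → IsMAdditive S) := by
  rw [hS.goto_mult]
  constructor
  · intro hadd
    have hmem := hS.kfold_sigmaS_succ_eq hadd
    exact le_antisymm (le_csInf ⟨_, hmem⟩ fun k hk => hS.sigmaS_le_of_kfold_succ_eq hk)
      (Nat.sInf_le hmem)
  · intro hpure hr
    refine hS.isMAdditive_of_isMPure hpure ?_
    have hpos := hS.one_le_sigmaS_mult
    rw [hr] at hpos ⊢
    exact Nat.sInf_mem (Nat.nonempty_of_pos_sInf hpos)

end GotoNS
end
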